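/- Let T be a tree on n vertices. Then the number of perfect matchings of the Cartesian product P_4 × T equals the product of (1 + 3α² + α⁴) taken over all non-negative eigenvalues α (with multiplicity) of the adjacency matrix of T, where P_4 is the path on 4 vertices. -/

import Mathlib

open SimpleGraph

/-- The number of perfect matchings of a graph `G`. -/
noncomputable def Pm {V : Type*} (G : SimpleGraph V) : ℕ :=
  Set.ncard {M : G.Subgraph | M.IsPerfectMatching}


lemma exists_leaf {V : Type*} [Fintype V] (T : SimpleGraph V) (hT : T.IsAcyclic) {a b : V}
    (hab : T.Adj a b) : ∃ l u, T.Adj l u ∧ ∀ w, T.Adj l w → w = u := by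
  classical
  let P : ℕ → Prop := fun n => ∃ (u v : V) (p : T.Walk u v), p.IsPath ∧ p.length = n
  have h1 : P 1 := ⟨a, b, hab.toWalk, by simp [hab.ne], rfl⟩
  have hb : ∀ n, P n → n ≤ Fintype.card V := by
    rintro n ⟨u, v, p, hp, rfl⟩
    exact hp.length_lt.le
  have hm := Nat.findGreatest_spec (P := P) (hb 1 h1) h1
  have hge := Nat.le_findGreatest (P := P) (hb 1 h1) h1
  set N := Nat.findGreatest P (Fintype.card V) with hN
  obtain ⟨u, v, p, hp, hl⟩ := hm
  have hnn : ¬ p.Nil := by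
    intro h
    have := SimpleGraph.Walk.length_eq_zero_iff.2 h
    omega
  refine ⟨u, p.snd, p.adj_snd hnn, fun w hw => ?_⟩
  by_cases hs : w ∈ p.support
  · exact hT.eq_snd_of_adj_start hp hw hs
  · have : P (N + 1) := ⟨w, v, SimpleGraph.Walk.cons hw.symm p, by simp [hp, hs], by simp [hl]⟩
    have := Nat.le_findGreatest (P := P) (hb _ this) this
    omega

open Classical in
/-- The matrix `diag(r) + i A`. -/
noncomputable def dmat {V : Type*} (T : SimpleGraph V) (r : V → ℝ) : Matrix V V ℂ :=
  Matrix.of fun a b => if a = b then (r a : ℂ) else if T.Adj a b then Complex.I else 0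

open Classical in
lemma det_leaf {V : Type*} [Fintype V] [DecidableEq V] (T T' : SimpleGraph V) (l u : V)
    (hlu : T.Adj l u) (hleaf : ∀ w, T.Adj l w → w = u)
    (hT' : T' = T.deleteEdges {s(l, u)}) (r r' : V → ℝ) (hr : r l ≠ 0)
    (hr' : r' = Function.update r u (r u + (r l)⁻¹)) :
    (dmat T r).det = (dmat T' r').det := by
  have hne : u ≠ l := hlu.ne'
  have hrc : (r l : ℂ) ≠ 0 := by exact_mod_cast hr
  rw [← Matrix.det_updateRow_add_smul_self _ hne (-(Complex.I / (r l : ℂ))),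
    ← Matrix.det_updateCol_add_smul_self _ hne (-(Complex.I / (r l : ℂ)))]
  congr 1
  have hl' : ∀ w, T.Adj w l → w = u := fun w hw => hleaf w hw.symm
  have e1 : ∀ w, T.Adj l w ↔ w = u := fun w => ⟨hleaf w, fun h => h ▸ hlu⟩
  have e2 : ∀ w, T.Adj w l ↔ w = u := fun w => ⟨hl' w, fun h => h ▸ hlu.symm⟩
  subst hT' hr'
  ext a b
  simp only [Matrix.updateCol_apply, Matrix.updateRow_apply, dmat, Matrix.of_apply, Pi.add_apply,
    Pi.smul_apply, smul_eq_mul, SimpleGraph.deleteEdges_adj, Set.mem_singleton_iff, Sym2.eq_iff,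
    Function.update_apply]
  by_cases hb : b = u
  · subst hb
    by_cases ha : a = b
    · subst ha
      have : ¬ l = a := fun h => hne h.symm
      simp [hne, this, e1, e2]
      field_simp
      simp
    · by_cases hal : a = l
      · subst hal
        simp [ha, e1]
        field_simp
        simp
      · simp [ha, hal, e2]
  · by_cases ha : a = u
    · subst ha
      by_cases hbl : b = l
      · subst hbl
        simp [hne, e2]
        field_simp
        simp
        intro h
        exact absurd h hb
      · have h3 : ¬ a = b := fun h => hb h.symm
        have h4 : ¬ l = b := fun h => hbl h.symm
        simp [h3, h4, hbl, hb, e1]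
    · simp [ha, hb]

lemma roots_neg {V : Type*} [Fintype V] [DecidableEq V]
    (T : SimpleGraph V) [DecidableRel T.Adj] (hT : T.Colorable 2) :
    ((T.adjMatrix ℝ).charpoly.roots).map (fun x => -x) = (T.adjMatrix ℝ).charpoly.roots := by
  obtain ⟨C⟩ := hT
  let ε : V → ℝ := fun v => if C v = 0 then 1 else -1
  have hε : ∀ v, ε v * ε v = 1 := fun v => by simp only [ε]; split_ifs <;> norm_num
  have hA : ∀ a b, T.Adj a b → ε a * ε b = -1 := fun a b hab => by
    have h := C.valid hab
    simp only [ε]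
    generalize C a = x at *
    generalize C b = y at *
    fin_cases x <;> fin_cases y <;> simp at *
  rw [← Polynomial.roots_comp_neg_X]
  have key : (T.adjMatrix ℝ).charpoly.comp (-Polynomial.X) =
      Polynomial.C ((-1) ^ Fintype.card V) * (T.adjMatrix ℝ).charpoly := by
    apply Polynomial.funext
    intro x
    rw [Polynomial.eval_comp, Polynomial.eval_mul, Polynomial.eval_C, Matrix.eval_charpoly,
      Matrix.eval_charpoly, ← Matrix.det_neg]
    have h1 : (Matrix.diagonal ε).det * (Matrix.diagonal ε).det = 1 := by
      rw [Matrix.det_diagonal, ← Finset.prod_mul_distrib]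
      simp [hε]
    have h2 : -(Matrix.scalar V x - T.adjMatrix ℝ) = Matrix.diagonal ε *
        (Matrix.scalar V (Polynomial.eval x (-Polynomial.X)) - T.adjMatrix ℝ) *
          Matrix.diagonal ε := by
      ext a b
      simp only [Matrix.mul_diagonal, Matrix.diagonal_mul, Matrix.neg_apply, Matrix.sub_apply,
        Matrix.scalar_apply, Matrix.diagonal_apply, SimpleGraph.adjMatrix_apply]
      by_cases hab : a = b
      · subst hab
        simp
        linear_combination (-x) * hε a
      · by_cases h : T.Adj a b
        · simp [hab, h]
          linear_combination hA a b h
        · simp [hab, h]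
    rw [h2, Matrix.det_mul, Matrix.det_mul]
    linear_combination (-(Matrix.scalar V (Polynomial.eval x (-Polynomial.X)) - T.adjMatrix ℝ).det) * h1
  rw [key, Polynomial.roots_C_mul]
  exact pow_ne_zero _ (by norm_num)

lemma det_const {V : Type*} [Fintype V] [DecidableEq V]
    (T : SimpleGraph V) [DecidableRel T.Adj] (c : ℝ) :
    (dmat T (fun _ => c)).det =
      (((T.adjMatrix ℝ).charpoly.roots).map
        (fun α : ℝ => (c : ℂ) + Complex.I * (α : ℂ))).prod := by
  have hH : (T.adjMatrix ℝ).IsHermitian := by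
    have := T.isSymm_adjMatrix (α := ℝ)
    rw [Matrix.IsHermitian, Matrix.conjTranspose_eq_transpose_of_trivial]
    exact this
  rw [hH.roots_charpoly_eq_eigenvalues, Multiset.map_map]
  have h1 : dmat T (fun _ => c) = (-Complex.I) •
      (Matrix.scalar V (Complex.I * (c : ℂ)) - (T.adjMatrix ℝ).map (Complex.ofRealHom)) := by
    ext a b
    simp only [dmat, Matrix.of_apply, Matrix.smul_apply, Matrix.sub_apply, Matrix.scalar_apply,
      Matrix.diagonal_apply, Matrix.map_apply, SimpleGraph.adjMatrix_apply, smul_eq_mul]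
    by_cases hab : a = b
    · subst hab
      simp
      linear_combination ((c : ℂ)) * Complex.I_mul_I
    · by_cases h : T.Adj a b <;> simp [hab, h]
  rw [h1, Matrix.det_smul, ← Matrix.eval_charpoly, Matrix.charpoly_map, hH.charpoly_eq]
  simp only [Polynomial.map_prod, Polynomial.eval_prod]
  rw [← Finset.card_univ, ← Finset.prod_const, ← Finset.prod_mul_distrib]
  change _ = ∏ i, _
  refine Finset.prod_congr rfl fun i _ => ?_
  simp
  linear_combination (-(c : ℂ)) * Complex.I_mul_I

lemma det_rhs {V : Type*} [Fintype V] [DecidableEq V]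
    (T : SimpleGraph V) [DecidableRel T.Adj] (hT : T.Colorable 2) (c d : ℝ) (hcd : c * d = 1)
    (hcd2 : c ^ 2 + d ^ 2 = 3) :
    (dmat T (fun _ => c)).det * (dmat T (fun _ => d)).det =
    (((((T.adjMatrix ℝ).charpoly.roots).filter (fun α => 0 ≤ α)).map
        (fun α => 1 + 3 * α ^ 2 + α ^ 4)).prod : ℝ) := by
  have hs := roots_neg T hT
  rw [det_const, det_const]
  generalize (T.adjMatrix ℝ).charpoly.roots = s at *
  rw [← Multiset.prod_map_mul]
  have hcd' : (c : ℂ) * d = 1 := by exact_mod_cast hcd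
  have hcd2' : (c : ℂ) ^ 2 + (d : ℂ) ^ 2 = 3 := by exact_mod_cast hcd2
  set g : ℝ → ℂ := fun α => ((c : ℂ) + Complex.I * α) * ((d : ℂ) + Complex.I * α) with hg
  have hsplit := Multiset.filter_add_not (fun α : ℝ => 0 ≤ α) s
  have hneg : s.filter (fun α : ℝ => ¬ 0 ≤ α) = (s.filter (fun α : ℝ => 0 < α)).map (fun x => -x) := by
    conv_lhs => rw [← hs]
    rw [Multiset.filter_map]
    congr 1
    apply Multiset.filter_congr
    intro x _
    simp
  have hpos : ((s.filter (fun α : ℝ => 0 < α)).map (fun α => g (-α))).prod =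
      ((s.filter (fun α : ℝ => 0 ≤ α)).map (fun α => g (-α))).prod := by
    rw [← Multiset.filter_add_not (fun α : ℝ => 0 < α) (s.filter (fun α : ℝ => 0 ≤ α))]
    rw [Multiset.filter_filter, Multiset.map_add, Multiset.prod_add]
    have e1 : s.filter (fun α : ℝ => 0 < α ∧ 0 ≤ α) = s.filter (fun α : ℝ => 0 < α) :=
      Multiset.filter_congr fun x _ => ⟨fun h => h.1, fun h => ⟨h, h.le⟩⟩
    rw [e1, Multiset.prod_eq_one (s := Multiset.map _ (Multiset.filter (fun a => ¬ 0 < a) _)),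
      mul_one]
    intro x hx
    simp only [Multiset.mem_map, Multiset.mem_filter] at hx
    obtain ⟨a, ⟨⟨_, h1⟩, h2⟩, rfl⟩ := hx
    have : a = 0 := le_antisymm (not_lt.1 h2) h1
    simp [hg, this, hcd']
  rw [← Complex.ofRealHom_eq_coe, map_multiset_prod, Multiset.map_map]
  conv_lhs => rw [← hsplit]
  rw [Multiset.map_add, Multiset.prod_add, hneg, Multiset.map_map]
  change _ * (Multiset.map (fun α => g (-α)) _).prod = _
  rw [hpos, ← Multiset.prod_map_mul]
  congr 1
  apply Multiset.map_congr rfl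
  intro α _
  simp [hg]
  linear_combination ((c : ℂ) * d + 1) * hcd' + (α : ℂ) ^ 2 * hcd2' + (-(α : ℂ) ^ 2 * ((c : ℂ) ^ 2 + d ^ 2) + (Complex.I ^2 - 1) * (α : ℂ) ^ 4) * Complex.I_sq

section Berezin
variable {V : Type*} [Fintype V] [DecidableEq V]

/-- Coefficient of the product of all variables. -/
noncomputable def bint (V : Type*) [Fintype V] : MvPolynomial (Fin 4 × V) ℝ →ₗ[ℝ] ℝ :=
  MvPolynomial.lcoeff ℝ (Finsupp.equivFunOnFinite.symm (fun _ => 1))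

lemma bint_apply (f : MvPolynomial (Fin 4 × V) ℝ) :
    bint V f = MvPolynomial.coeff (Finsupp.equivFunOnFinite.symm (fun _ => 1)) f := rfl

lemma bint_sq (a : Fin 4 × V) (f : MvPolynomial (Fin 4 × V) ℝ) :
    bint V (MvPolynomial.X a * (MvPolynomial.X a * f)) = 0 := by
  rw [bint_apply, MvPolynomial.coeff_X_mul', MvPolynomial.coeff_X_mul']
  simp

lemma bint_free (a : Fin 4 × V) (f : MvPolynomial (Fin 4 × V) ℝ)
    (hf : f ∈ MvPolynomial.supported ℝ ({a}ᶜ : Set (Fin 4 × V))) : bint V f = 0 := by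
  rw [bint_apply]
  by_contra h
  have h1 := MvPolynomial.mem_support_iff.2 h
  have h2 : a ∈ f.vars := MvPolynomial.mem_vars_iff_mem_support a |>.2 ⟨_, h1, by simp⟩
  have := MvPolynomial.mem_supported.1 hf h2
  simp at this

/-- ideal of squares -/
noncomputable def sqI (V : Type*) : Ideal (MvPolynomial (Fin 4 × V) ℝ) :=
  Ideal.span (Set.range fun a => MvPolynomial.X a ^ 2)

lemma bint_ideal (f : MvPolynomial (Fin 4 × V) ℝ) (hf : f ∈ sqI V) : bint V f = 0 := by
  refine Submodule.span_induction (p := fun f _ => ∀ g, bint V (g * f) = 0) ?_ ?_ ?_ ?_ hf 1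
    |> fun h => by simpa using h
  · rintro _ ⟨a, rfl⟩ g
    have := bint_sq a g
    rw [← this]
    congr 1
    ring
  · simp
  · intro x y _ _ hx hy g
    rw [mul_add, map_add, hx, hy, add_zero]
  · intro c x _ hx g
    rw [smul_eq_mul, ← mul_assoc, hx]

lemma bint_congr (f g h : MvPolynomial (Fin 4 × V) ℝ)
    (hfg : Ideal.Quotient.mk (sqI V) f = Ideal.Quotient.mk (sqI V) g) :
    bint V (f * h) = bint V (g * h) := by
  rw [← sub_eq_zero, ← map_sub, ← sub_mul]
  apply bint_ideal
  exact Ideal.mul_mem_right _ _ (Ideal.Quotient.eq.1 hfg)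

lemma mk_sq (a : Fin 4 × V) : Ideal.Quotient.mk (sqI V) (MvPolynomial.X a) ^ 2 = 0 := by
  rw [← map_pow, Ideal.Quotient.eq_zero_iff_mem]
  exact Ideal.subset_span ⟨a, rfl⟩

/-- fibre monomial -/
noncomputable def mon (l : V) (s : Finset (Fin 4)) : MvPolynomial (Fin 4 × V) ℝ :=
  ∏ i ∈ s, MvPolynomial.X (i, l)

/-- polynomials free of the fibre over `l` -/
noncomputable def fre (l : V) : Subalgebra ℝ (MvPolynomial (Fin 4 × V) ℝ) :=
  MvPolynomial.supported ℝ {p : Fin 4 × V | p.2 ≠ l}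

lemma X_mem_fre {l v : V} (h : v ≠ l) (i : Fin 4) : MvPolynomial.X (i, v) ∈ fre l :=
  MvPolynomial.X_mem_supported.2 h

lemma mon_mem_fre {l v : V} (h : v ≠ l) (s : Finset (Fin 4)) : mon v s ∈ fre l :=
  Subalgebra.prod_mem _ fun i _ => X_mem_fre h i

lemma bint_mon (l : V) (s t : Finset (Fin 4)) (h : MvPolynomial (Fin 4 × V) ℝ) (hh : h ∈ fre l) :
    bint V (mon l s * mon l t * h) = if t = sᶜ then bint V (mon l Finset.univ * h) else 0 := by
  by_cases h1 : ∃ i, i ∈ s ∧ i ∈ t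
  · obtain ⟨i, hs, ht⟩ := h1
    rw [if_neg]
    · have e1 : mon l s = MvPolynomial.X (i, l) * mon l (s.erase i) :=
        (Finset.mul_prod_erase s _ hs).symm
      have e2 : mon l t = MvPolynomial.X (i, l) * mon l (t.erase i) :=
        (Finset.mul_prod_erase t _ ht).symm
      rw [← bint_sq (i, l) (mon l (s.erase i) * mon l (t.erase i) * h), e1, e2]
      congr 1
      ring
    · rintro rfl
      simp at ht
      exact ht hs
  · by_cases h2 : ∃ i, i ∉ s ∧ i ∉ t
    · obtain ⟨i, hs, ht⟩ := h2
      rw [if_neg]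
      · apply bint_free (i, l)
        have hm : ∀ r : Finset (Fin 4), i ∉ r →
            mon l r ∈ MvPolynomial.supported ℝ ({(i, l)}ᶜ : Set (Fin 4 × V)) := by
          intro r hr
          refine Subalgebra.prod_mem _ fun j hj => MvPolynomial.X_mem_supported.2 ?_
          simp
          rintro rfl
          exact hr hj
        refine mul_mem (mul_mem (hm s hs) (hm t ht)) (MvPolynomial.supported_mono ?_ hh)
        rintro ⟨j, v⟩ hv
        simp at hv ⊢
        exact fun _ => hv
      · rintro rfl
        simp at ht
        exact hs ht
    · have : t = sᶜ := by
        ext i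
        simp
        push Not at h1 h2
        exact ⟨fun ht hs => h1 i hs ht, fun hs => h2 i hs⟩
      rw [if_pos this, this, mon, mon, Finset.prod_mul_prod_compl, mon]

/-- edge factor -/
noncomputable def edg (e : Sym2 V) : MvPolynomial (Fin 4 × V) ℝ :=
  ∏ i : Fin 4, (1 + (e.map (fun v => (MvPolynomial.X (i, v) : MvPolynomial (Fin 4 × V) ℝ))).mul)

lemma edg_eq (l u : V) : edg s(l, u) = ∑ t : Finset (Fin 4), mon l t * mon u t := by
  simp only [edg, Finset.prod_one_add, Finset.powerset_univ]
  refine Finset.sum_congr rfl fun t _ => ?_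
  rw [mon, mon, ← Finset.prod_mul_distrib]
  rfl

lemma edg_mem_fre (l : V) (e : Sym2 V) (he : l ∉ e) : edg e ∈ fre l := by
  induction e with | _ a b =>
  simp at he
  refine Subalgebra.prod_mem _ fun i _ => add_mem (one_mem _) ?_
  exact mul_mem (X_mem_fre (Ne.symm he.1) i) (X_mem_fre (Ne.symm he.2) i)

lemma bint_mon_edg (l u : V) (hlu : u ≠ l) (s : Finset (Fin 4))
    (h : MvPolynomial (Fin 4 × V) ℝ) (hh : h ∈ fre l) :
    bint V (mon l s * edg s(l, u) * h) = bint V (mon l Finset.univ * (mon u sᶜ * h)) := by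
  rw [edg_eq, Finset.mul_sum, Finset.sum_mul, map_sum]
  have : ∀ t, bint V (mon l s * (mon l t * mon u t) * h) =
      if t = sᶜ then bint V (mon l Finset.univ * (mon u t * h)) else 0 := by
    intro t
    rw [← bint_mon l s t _ (mul_mem (mon_mem_fre hlu t) hh)]
    congr 1
    ring
  simp [this]

lemma bint_mon' (l : V) (s : Finset (Fin 4)) (h : MvPolynomial (Fin 4 × V) ℝ) (hh : h ∈ fre l) :
    bint V (mon l s * h) = if s = Finset.univ then bint V (mon l Finset.univ * h) else 0 := by
  have := bint_mon l s ∅ h hh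
  simp only [mon, Finset.prod_empty, mul_one] at this
  simp only [mon, this]
  congr 1
  simp [eq_comm]

/-- vertex factor, product form -/
noncomputable def wpr (p s q : ℝ) (l : V) : MvPolynomial (Fin 4 × V) ℝ :=
  (1 + MvPolynomial.C p * (MvPolynomial.X (0, l) * MvPolynomial.X (1, l))) *
  (1 + MvPolynomial.C s * (MvPolynomial.X (1, l) * MvPolynomial.X (2, l))) *
  (1 + MvPolynomial.C p * (MvPolynomial.X (2, l) * MvPolynomial.X (3, l))) *
  (1 + MvPolynomial.C q * (MvPolynomial.X (0, l) * MvPolynomial.X (3, l)))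

/-- vertex factor, sum form -/
noncomputable def wsm (c p s q D : ℝ) (l : V) : MvPolynomial (Fin 4 × V) ℝ :=
  c • mon l ∅ + p • mon l {0, 1} + p • mon l {2, 3} + s • mon l {1, 2} + q • mon l {0, 3} +
    D • mon l Finset.univ

lemma ring_aux {R : Type*} [CommRing R] (p s q x0 x1 x2 x3 : R) (h0 : x0 ^ 2 = 0) (h1 : x1 ^ 2 = 0)
    (h2 : x2 ^ 2 = 0) (h3 : x3 ^ 2 = 0) :
    (1 + p * (x0 * x1)) * (1 + s * (x1 * x2)) * (1 + p * (x2 * x3)) * (1 + q * (x0 * x3)) =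
    1 + p * (x0 * x1) + p * (x2 * x3) + s * (x1 * x2) + q * (x0 * x3)
      + (p ^ 2 + s * q) * (x0 * x1 * x2 * x3) := by
  grind

lemma wpr_mk (p s q : ℝ) (l : V) : Ideal.Quotient.mk (sqI V) (wpr p s q l) =
    Ideal.Quotient.mk (sqI V) (wsm 1 p s q (p ^ 2 + s * q) l) := by
  have := ring_aux (Ideal.Quotient.mk (sqI V) (MvPolynomial.C p))
    (Ideal.Quotient.mk (sqI V) (MvPolynomial.C s)) (Ideal.Quotient.mk (sqI V) (MvPolynomial.C q))
    _ _ _ _ (mk_sq (0, l)) (mk_sq (1, l)) (mk_sq (2, l)) (mk_sq (3, l))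
  simp only [wpr, map_mul, map_add, map_one, this]
  simp [wsm, mon, MvPolynomial.smul_eq_C_mul, Fin.prod_univ_four]

lemma wpr_add (p s q p' s' q' : ℝ) (l : V) :
    Ideal.Quotient.mk (sqI V) (wpr p s q l * wpr p' s' q' l) =
    Ideal.Quotient.mk (sqI V) (wpr (p + p') (s + s') (q + q') l) := by
  have aux : ∀ {R : Type _} [CommRing R] (a b x y : R), x ^ 2 = 0 →
      (1 + a * (x * y)) * (1 + b * (x * y)) = 1 + (a + b) * (x * y) := by
    intro R _ a b x y h
    linear_combination a * b * y ^ 2 * h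
  simp only [wpr, map_mul, map_add, map_one]
  rw [← aux _ _ _ _ (mk_sq (0, l)), ← aux _ _ _ _ (mk_sq (1, l)), ← aux _ _ _ _ (mk_sq (2, l)),
    ← aux _ _ _ _ (mk_sq (0, l))]
  ring

lemma wpr_mem_fre (p s q : ℝ) {l v : V} (h : v ≠ l) : wpr p s q v ∈ fre l := by
  have hC : ∀ c : ℝ, MvPolynomial.C c ∈ fre l := fun c => Subalgebra.algebraMap_mem _ c
  unfold wpr
  refine mul_mem (mul_mem (mul_mem ?_ ?_) ?_) ?_ <;>
  exact add_mem (one_mem _) (mul_mem (hC _) (mul_mem (X_mem_fre h _) (X_mem_fre h _)))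

lemma bint_wpr (p s q : ℝ) (l : V) (h : MvPolynomial (Fin 4 × V) ℝ) (hh : h ∈ fre l) :
    bint V (wpr p s q l * h) = (p ^ 2 + s * q) * bint V (mon l Finset.univ * h) := by
  rw [bint_congr _ _ _ (wpr_mk p s q l)]
  simp only [wsm, add_mul, map_add, smul_mul_assoc, map_smul]
  rw [bint_mon' l ∅ h hh, bint_mon' l {0, 1} h hh, bint_mon' l {2, 3} h hh, bint_mon' l {1, 2} h hh,
    bint_mon' l {0, 3} h hh, if_neg (by decide), if_neg (by decide), if_neg (by decide),
    if_neg (by decide), if_neg (by decide)]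
  simp
  ring

lemma bint_wpr_edg (p s q : ℝ) (l u : V) (hlu : u ≠ l) (hD : p ^ 2 + s * q ≠ 0)
    (h : MvPolynomial (Fin 4 × V) ℝ) (hh : h ∈ fre l) :
    bint V (wpr p s q l * (edg s(l, u) * h)) =
      bint V (wpr p s q l * (wpr (p / (p ^ 2 + s * q)) (q / (p ^ 2 + s * q))
        (s / (p ^ 2 + s * q)) u * h)) := by
  set D := p ^ 2 + s * q with hDdef
  rw [bint_wpr _ _ _ _ _ (mul_mem (wpr_mem_fre _ _ _ hlu) hh), bint_congr _ _ _ (wpr_mk p s q l)]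
  have e : bint V (mon l Finset.univ * (wpr (p / D) (q / D) (s / D) u * h)) =
      bint V (wpr (p / D) (q / D) (s / D) u * (mon l Finset.univ * h)) := by
    congr 1; ring
  rw [e, bint_congr _ _ _ (wpr_mk _ _ _ u), ← mul_assoc]
  simp only [wsm, add_mul, map_add, smul_mul_assoc, map_smul]
  simp only [bint_mon_edg l u hlu _ h hh]
  have c1 : (∅ : Finset (Fin 4))ᶜ = Finset.univ := by decide
  have c2 : ({0, 1} : Finset (Fin 4))ᶜ = {2, 3} := by decide
  have c3 : ({2, 3} : Finset (Fin 4))ᶜ = {0, 1} := by decide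
  have c4 : ({1, 2} : Finset (Fin 4))ᶜ = {0, 3} := by decide
  have c5 : ({0, 3} : Finset (Fin 4))ᶜ = {1, 2} := by decide
  have c6 : (Finset.univ : Finset (Fin 4))ᶜ = ∅ := by decide
  rw [c1, c2, c3, c4, c5, c6]
  simp only [mul_left_comm (mon l Finset.univ) (mon u _) h, smul_eq_mul]
  rw [← hDdef]
  field_simp
  linear_combination (bint V (mon u Finset.univ * (mon l Finset.univ * h))) * hDdef

lemma bint_prod_wpr (p s q : V → ℝ) :
    bint V (∏ v, wpr (p v) (s v) (q v) v) = ∏ v, ((p v) ^ 2 + s v * q v) := by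
  have key : ∀ A : Finset V, bint V ((∏ v ∈ A, wpr (p v) (s v) (q v) v) * ∏ v ∈ Aᶜ, mon v Finset.univ) =
      ∏ v ∈ A, ((p v) ^ 2 + s v * q v) := by
    intro A
    induction A using Finset.induction_on with
    | empty =>
      simp only [Finset.prod_empty, one_mul, Finset.compl_empty, mon]
      rw [Finset.prod_comm, ← Fintype.prod_prod_type
        (f := fun x : Fin 4 × V => (MvPolynomial.X (x.1, x.2) : MvPolynomial (Fin 4 × V) ℝ)),
        bint_apply]
      have : (∏ x : Fin 4 × V, (MvPolynomial.X (x.1, x.2) : MvPolynomial (Fin 4 × V) ℝ)) =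
          MvPolynomial.monomial (Finsupp.equivFunOnFinite.symm (fun _ => 1)) 1 := by
        rw [MvPolynomial.monomial_eq, Finsupp.prod_fintype _ _ (by simp)]
        simp
      rw [this]
      simp
    | insert a A ha ih =>
      rw [Finset.prod_insert ha, Finset.prod_insert ha, mul_assoc, bint_wpr, ← ih]
      · congr 2
        have : Aᶜ = insert a (insert a A)ᶜ := by
          ext x
          simp
          by_cases h : x = a
          · simp [h, ha]
          · simp [h]
        rw [this, Finset.prod_insert (by simp)]
        ring
      · refine mul_mem (Subalgebra.prod_mem _ fun v hv => wpr_mem_fre _ _ _ ?_)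
          (Subalgebra.prod_mem _ fun v hv => mon_mem_fre ?_ _)
        · rintro rfl
          exact ha hv
        · rintro rfl
          simp at hv
  simpa using key Finset.univ

end Berezin

lemma aux_inv (x y r r' c d : ℝ) (hr : r ≠ 0) (hr' : r' ≠ 0) (h : c * x + d * y = r') :
    c * (x / (r * r')) + d * (y / (r * r')) = r⁻¹ := by
  field_simp
  linarith

set_option maxHeartbeats 2000000 in
lemma main_ind {V : Type*} [Fintype V] [DecidableEq V] (c d : ℝ) (hc : 0 < c) (hd : 0 < d)
    (hcd : c * d = 1) (hcd2 : c ^ 2 + d ^ 2 = 3) (n : ℕ) :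
    ∀ (T : SimpleGraph V) (E : Finset (Sym2 V)), (E : Set (Sym2 V)) = T.edgeSet → T.IsAcyclic →
    E.card = n →
    ∀ a b : V → ℝ, (∀ v, 0 < a v) → (∀ v, 0 ≤ b v) →
    (bint V ((∏ v, wpr (a v + b v) (a v) (b v) v) * ∏ e ∈ E, edg e) : ℂ) =
      (dmat T (fun v => c * a v + d * b v)).det * (dmat T (fun v => d * a v + c * b v)).det := by
  have hdet : ∀ x y : ℝ, (x + y) ^ 2 + x * y = (c * x + d * y) * (d * x + c * y) := by
    intro x y
    linear_combination (-(x ^ 2) - y ^ 2) * hcd - x * y * hcd2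
  induction n with
  | zero =>
    intro T E hE hT hn a b ha hb
    have hE0 : E = ∅ := Finset.card_eq_zero.1 hn
    subst hE0
    have hbot : ∀ x y, ¬ T.Adj x y := by
      intro x y h
      have : s(x, y) ∈ T.edgeSet := h
      rw [← hE] at this
      simp at this
    have hdm : ∀ r : V → ℝ, (dmat T r).det = ∏ v, (r v : ℂ) := by
      intro r
      rw [← Matrix.det_diagonal]
      congr 1
      ext x y
      simp [dmat, hbot, Matrix.diagonal_apply]
    rw [hdm, hdm, Finset.prod_empty, mul_one, bint_prod_wpr, ← Finset.prod_mul_distrib]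
    push_cast
    refine Finset.prod_congr rfl fun v _ => ?_
    exact_mod_cast hdet (a v) (b v)
  | succ n ih =>
    intro T E hE hT hn a b ha hb
    obtain ⟨e, he⟩ : E.Nonempty := Finset.card_pos.1 (by omega)
    have heT : e ∈ T.edgeSet := by rw [← hE]; exact he
    obtain ⟨l, u, hlu, hleaf⟩ : ∃ l u, T.Adj l u ∧ ∀ w, T.Adj l w → w = u := by
      induction e with | _ x y => exact exists_leaf T hT heT
    have hne : u ≠ l := hlu.ne'
    have hmem : s(l, u) ∈ E := by
      rw [← Finset.mem_coe, hE]
      exact hlu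
    set T' := T.deleteEdges {s(l, u)} with hT'
    set D := (a l + b l) ^ 2 + a l * b l with hD
    have hDpos : 0 < D := by
      have := ha l
      have := hb l
      positivity
    set a' := Function.update a u (a u + b l / D) with ha'
    set b' := Function.update b u (b u + a l / D) with hb'
    have hrl : 0 < c * a l + d * b l := by
      have := ha l
      have := hb l
      positivity
    have hrl' : 0 < d * a l + c * b l := by
      have := ha l
      have := hb l
      positivity
    have hDf : D = (c * a l + d * b l) * (d * a l + c * b l) := hdet _ _
    rw [det_leaf T T' l u hlu hleaf hT' _ (fun v => c * a' v + d * b' v) hrl.ne',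
      det_leaf T T' l u hlu hleaf hT' _ (fun v => d * a' v + c * b' v) hrl'.ne',
      ← ih T' (E.erase s(l, u)) (by simp [hT', hE]) (hT.anti (T.deleteEdges_le _))
        (by rw [Finset.card_erase_of_mem hmem]; omega) a' b']
    · rw [Complex.ofReal_inj]
      have hfree : ∀ e ∈ E.erase s(l, u), edg e ∈ fre l := by
        intro e he
        apply edg_mem_fre
        intro hle
        obtain ⟨w, rfl⟩ := hle
        have h1 := Finset.mem_of_mem_erase he
        rw [← Finset.mem_coe, hE] at h1
        have := hleaf w h1
        subst this
        simp at he
      have hu : u ∈ (Finset.univ.erase l) := by simp [hne]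
      rw [← Finset.mul_prod_erase E _ hmem, ← Finset.mul_prod_erase Finset.univ _ (Finset.mem_univ l),
        ← Finset.mul_prod_erase _ _ hu, ← Finset.mul_prod_erase Finset.univ
          (fun v => wpr (a' v + b' v) (a' v) (b' v) v) (Finset.mem_univ l),
        ← Finset.mul_prod_erase _ (fun v => wpr (a' v + b' v) (a' v) (b' v) v) hu]
      have hrest : ∏ v ∈ (Finset.univ.erase l).erase u, wpr (a' v + b' v) (a' v) (b' v) v =
          ∏ v ∈ (Finset.univ.erase l).erase u, wpr (a v + b v) (a v) (b v) v := by
        refine Finset.prod_congr rfl fun v hv => ?_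
        have : v ≠ u := Finset.ne_of_mem_erase hv
        simp [ha', hb', this]
      rw [hrest]
      set P := ∏ v ∈ (Finset.univ.erase l).erase u, wpr (a v + b v) (a v) (b v) v with hP
      set Q := ∏ e ∈ E.erase s(l, u), edg e with hQ
      have hQf : Q ∈ fre l := Subalgebra.prod_mem _ hfree
      have hPf : P ∈ fre l := Subalgebra.prod_mem _ fun v hv => wpr_mem_fre _ _ _
        (Finset.ne_of_mem_erase (Finset.mem_of_mem_erase hv))
      have hl1 : a' l = a l := by simp [ha', hne.symm]
      have hl2 : b' l = b l := by simp [hb', hne.symm]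
      have hu1 : a' u = a u + b l / D := by simp [ha']
      have hu2 : b' u = b u + a l / D := by simp [hb']
      have e1 : wpr (a l + b l) (a l) (b l) l * (wpr (a u + b u) (a u) (b u) u * P) *
          (edg s(l, u) * Q) = wpr (a l + b l) (a l) (b l) l * (edg s(l, u) *
            (wpr (a u + b u) (a u) (b u) u * P * Q)) := by ring
      rw [e1, bint_wpr_edg _ _ _ _ _ hne hDpos.ne' _
        (mul_mem (mul_mem (wpr_mem_fre _ _ _ hne) hPf) hQf), ← hD, hl1, hl2, hu1, hu2]
      have e2 : a u + b l / D + (b u + a l / D) = a u + b u + (a l + b l) / D := by ring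
      rw [e2]
      have e3 := bint_congr _ _ (wpr (a l + b l) (a l) (b l) l * P * Q)
        (wpr_add (a u + b u) (a u) (b u) ((a l + b l) / D) (b l / D) (a l / D) u)
      refine Eq.trans (congrArg _ ?_) (e3.trans (congrArg _ ?_))
      · ring
      · ring
    · intro v
      by_cases h : v = u
      · subst h
        have := ha v
        have := hb l
        simp only [ha', Function.update_self]
        positivity
      · simp [ha', h, ha]
    · intro v
      by_cases h : v = u
      · subst h
        have := hb v
        have := (ha l).le
        simp only [hb', Function.update_self]
        positivity
      · simp [hb', h, hb]
    · funext v
      by_cases h : v = u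
      · subst h
        simp only [ha', hb', Function.update_self]
        rw [hDf, mul_comm (c * a l + d * b l)]
        have := aux_inv (b l) (a l) (d * a l + c * b l) (c * a l + d * b l) d c hrl'.ne' hrl.ne'
          (by ring)
        linear_combination this
      · simp [ha', hb', h]
    · funext v
      by_cases h : v = u
      · subst h
        simp only [ha', hb', Function.update_self]
        rw [hDf]
        have := aux_inv (b l) (a l) (c * a l + d * b l) (d * a l + c * b l) c d hrl.ne' hrl'.ne'
          (by ring)
        linear_combination this
      · simp [ha', hb', h]

open Classical in
lemma existsUnique_iff_card {W : Type*} [Fintype W] (S : Finset (Sym2 W)) (v : W) :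
    (∃! w, s(v, w) ∈ S) ↔ (S.filter (fun e => v ∈ e)).card = 1 := by
  rw [Finset.card_eq_one]
  constructor
  · rintro ⟨w, hw, hu⟩
    refine ⟨s(v, w), ?_⟩
    ext e
    simp only [Finset.mem_filter, Finset.mem_singleton]
    constructor
    · rintro ⟨he, ⟨x, rfl⟩⟩
      rw [hu x he]
    · rintro rfl
      exact ⟨hw, by simp⟩
  · rintro ⟨e, he⟩
    have h1 : e ∈ S.filter (fun e => v ∈ e) := by simp [he]
    obtain ⟨h2, ⟨w, rfl⟩⟩ := Finset.mem_filter.1 h1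
    refine ⟨w, h2, fun y hy => ?_⟩
    have h3 : s(v, y) ∈ S.filter (fun e => v ∈ e) := by simp [hy]
    rw [he, Finset.mem_singleton] at h3
    rcases (by simpa using h3 : y = w ∨ v = w ∧ y = v) with h | ⟨h, h'⟩
    · exact h
    · rw [h', h]

open Classical in
lemma Pm_eq_card {W : Type*} [Fintype W] (G : SimpleGraph W) (E : Finset (Sym2 W))
    (hE : (E : Set (Sym2 W)) = G.edgeSet) :
    Pm G = (E.powerset.filter (fun S => ∀ v, (S.filter (fun e => v ∈ e)).card = 1)).card := by
  rw [Pm, ← Set.ncard_coe_finset]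
  refine Set.ncard_congr (fun M _ => M.edgeSet.toFinset) ?_ ?_ ?_
  · intro M hM
    simp only [Finset.coe_filter, Finset.mem_powerset, Set.mem_ofPred_eq]
    constructor
    · rw [← Finset.coe_subset, hE]
      simpa using M.edgeSet_subset
    · intro v
      rw [← existsUnique_iff_card]
      have := Subgraph.isPerfectMatching_iff.1 hM v
      simpa using this
  · intro M N hM hN h
    refine Subgraph.IsMatching.injOn_edgeSet hM.1 hN.1 ?_
    simpa using h
  · intro S hS
    simp only [Finset.coe_filter, Finset.mem_powerset, Set.mem_ofPred_eq] at hS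
    obtain ⟨hSE, hS1⟩ := hS
    let M : G.Subgraph :=
      { verts := Set.univ
        Adj := fun x y => s(x, y) ∈ S
        adj_sub := by
          intro x y h
          have : s(x, y) ∈ (E : Set (Sym2 W)) := hSE h
          rw [hE] at this
          exact this
        edge_vert := by intros; trivial
        symm := ⟨by
          intro x y h
          rw [Sym2.eq_swap]
          exact h⟩ }
    refine ⟨M, ?_, ?_⟩
    · refine Subgraph.isPerfectMatching_iff.2 fun v => ?_
      exact (existsUnique_iff_card S v).2 (hS1 v)
    · ext e
      induction e with | _ x y => simp [M]

open Classical in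
lemma Pm_eq_bint {V : Type*} [Fintype V] (G : SimpleGraph (Fin 4 × V))
    (E : Finset (Sym2 (Fin 4 × V))) (hE : (E : Set (Sym2 (Fin 4 × V))) = G.edgeSet) :
    (Pm G : ℝ) = bint V (∏ e ∈ E,
      (1 + (e.map (fun x => (MvPolynomial.X x : MvPolynomial (Fin 4 × V) ℝ))).mul)) := by
  rw [Pm_eq_card G E hE, Finset.prod_one_add, map_sum, Finset.card_filter]
  push_cast
  refine Finset.sum_congr rfl fun S hS => ?_
  have h1 : ∀ e ∈ S, (e.map (fun x => (MvPolynomial.X x : MvPolynomial (Fin 4 × V) ℝ))).mul =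
      MvPolynomial.monomial (Finsupp.equivFunOnFinite.symm (fun x => if x ∈ e then 1 else 0)) 1 := by
    intro e he
    have he' : e ∈ G.edgeSet := by
      rw [← hE]
      exact Finset.mem_powerset.1 hS he
    induction e with | _ a b =>
    have hab : a ≠ b := G.ne_of_adj he'
    have : (Finsupp.equivFunOnFinite.symm (fun x => if x ∈ s(a, b) then 1 else 0) :
        (Fin 4 × V) →₀ ℕ) = Finsupp.single a 1 + Finsupp.single b 1 := by
      ext x
      simp only [Finsupp.equivFunOnFinite_symm_apply_apply, Finsupp.add_apply,
        Finsupp.single_apply, Sym2.mem_iff]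
      by_cases h : x = a
      · subst h
        simp [hab.symm]
      · by_cases h' : x = b
        · subst h'
          simp [hab]
        · simp [h, h', Ne.symm h, Ne.symm h']
    rw [this]
    change MvPolynomial.X a * MvPolynomial.X b = _
    simp [MvPolynomial.X, MvPolynomial.monomial_mul]
  rw [Finset.prod_congr rfl h1, ← MvPolynomial.monomial_sum_one (R := ℝ)]
  rw [bint_apply, MvPolynomial.coeff_monomial]
  congr 1
  rw [eq_iff_iff, Finsupp.ext_iff]
  refine forall_congr' fun v => ?_
  simp [Finsupp.finsetSum_apply]
  congr!

open Classical in
lemma boxProd_prod {V : Type*} [Fintype V] (T : SimpleGraph V) (E : Finset (Sym2 V))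
    (hE : (E : Set (Sym2 V)) = T.edgeSet) {M : Type*} [CommMonoid M]
    (f : Sym2 (Fin 4 × V) → M) (F : Finset (Sym2 (Fin 4 × V)))
    (hF : (F : Set (Sym2 (Fin 4 × V))) = (pathGraph 4 □ T).edgeSet) :
    ∏ e ∈ F, f e =
      (∏ v, f s((0, v), (1, v)) * f s((1, v), (2, v)) * f s((2, v), (3, v))) *
        ∏ e ∈ E, ∏ i : Fin 4, f (e.map (fun v => (i, v))) := by
  have hFF : F = (pathGraph 4 □ T).edgeFinset := by
    rw [← Finset.coe_inj, hF, SimpleGraph.coe_edgeFinset]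
  rw [hFF]
  have hET : ∀ x y, s(x, y) ∈ E ↔ T.Adj x y := by
    intro x y
    rw [← Finset.mem_coe, hE]
    rfl
  let g1 : V × Fin 3 → Sym2 (Fin 4 × V) := fun p => s((p.2.castSucc, p.1), (p.2.succ, p.1))
  let g2 : Sym2 V × Fin 4 → Sym2 (Fin 4 × V) := fun p => p.1.map (fun v => (p.2, v))
  have i1 : Function.Injective g1 := by
    rintro ⟨v, j⟩ ⟨w, k⟩ h
    simp only [g1, Sym2.eq_iff, Prod.mk.injEq] at h
    rcases h with ⟨⟨h1, h2⟩, _⟩ | ⟨⟨h1, h2⟩, h3, h4⟩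
    · simp at h1
      rw [h1, h2]
    · exfalso
      simp [Fin.ext_iff] at h1 h3
      omega
  have i2 : Function.Injective g2 := by
    rintro ⟨e, i⟩ ⟨e', j⟩ h
    simp only [g2] at h
    have hij : i = j := by
      induction e with | _ a b =>
      induction e' with | _ c d =>
      simp only [Sym2.map_mk, Sym2.eq_iff, Prod.mk.injEq] at h
      tauto
    subst hij
    have := Sym2.map.injective (f := fun v : V => (i, v)) (fun a b h => by simpa using h) h
    rw [this]
  have hu : (pathGraph 4 □ T).edgeFinset =
      (Finset.univ.image g1) ∪ ((E ×ˢ Finset.univ).image g2) := by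
    ext e
    induction e with | _ x y =>
    obtain ⟨i, v⟩ := x
    obtain ⟨j, w⟩ := y
    simp only [SimpleGraph.mem_edgeFinset, SimpleGraph.mem_edgeSet, boxProd_adj, pathGraph_adj,
      Finset.mem_union, Finset.mem_image, Finset.mem_univ, true_and, Finset.mem_product, and_true]
    constructor
    · rintro (⟨h | h, rfl⟩ | ⟨h, rfl⟩)
      · left
        refine ⟨(v, ⟨i, by omega⟩), ?_⟩
        simp only [g1, Sym2.eq_iff, Prod.mk.injEq, Fin.ext_iff]
        left
        simp [h]
      · left
        refine ⟨(v, ⟨j, by omega⟩), ?_⟩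
        simp only [g1, Sym2.eq_iff, Prod.mk.injEq, Fin.ext_iff]
        right
        simp [h]
      · right
        exact ⟨(s(v, w), i), (hET _ _).2 h, rfl⟩
    · rintro (⟨⟨z, k⟩, h⟩ | ⟨⟨e, k⟩, he, h⟩)
      · left
        simp only [g1, Sym2.eq_iff, Prod.mk.injEq] at h
        rcases h with ⟨⟨h1, h2⟩, h3, h4⟩ | ⟨⟨h1, h2⟩, h3, h4⟩
        · subst h1 h2 h3
          simp [h4]
        · subst h1 h2 h3
          simp [h4]
      · right
        induction e with | _ a b =>
        have := (hET _ _).1 he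
        simp only [g2, Sym2.map_mk, Sym2.eq_iff, Prod.mk.injEq] at h
        rcases h with ⟨⟨h1, h2⟩, h3, h4⟩ | ⟨⟨h1, h2⟩, h3, h4⟩
        · subst h1 h2 h3 h4
          exact ⟨this, rfl⟩
        · subst h1 h2 h3 h4
          exact ⟨this.symm, rfl⟩
  have hd : Disjoint (Finset.univ.image g1) ((E ×ˢ Finset.univ).image g2) := by
    rw [Finset.disjoint_left]
    intro e h1 h2
    simp only [Finset.mem_image, Finset.mem_univ, true_and] at h1 h2
    obtain ⟨⟨z, k⟩, rfl⟩ := h1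
    obtain ⟨⟨e, i⟩, _, h⟩ := h2
    induction e with | _ a b =>
    simp only [g1, g2, Sym2.map_mk, Sym2.eq_iff, Prod.mk.injEq] at h
    simp [Fin.ext_iff] at h
    omega
  rw [hu, Finset.prod_union hd, Finset.prod_image i1.injOn, Finset.prod_image i2.injOn,
    Finset.prod_product, Fintype.prod_prod_type]
  congr 1
  refine Finset.prod_congr rfl fun v _ => ?_
  rw [Fin.prod_univ_three]
  rfl

theorem pm_p4_boxProd_tree {V : Type*} [Fintype V] [DecidableEq V]
    (T : SimpleGraph V) [DecidableRel T.Adj] (hT : T.IsTree) :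
    (Pm (pathGraph 4 □ T) : ℝ) =
      ((((T.adjMatrix ℝ).charpoly.roots).filter (fun α => 0 ≤ α)).map
        (fun α => 1 + 3 * α ^ 2 + α ^ 4)).prod := by
  classical
  have hc : 0 < Real.goldenRatio := Real.goldenRatio_pos
  have hsq : Real.goldenRatio ^ 2 = Real.goldenRatio + 1 := Real.goldenRatio_sq
  have hcd : Real.goldenRatio * (Real.goldenRatio - 1) = 1 := by linear_combination hsq
  have hcd2 : Real.goldenRatio ^ 2 + (Real.goldenRatio - 1) ^ 2 = 3 := by
    linear_combination 2 * hsq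
  have hd : 0 < Real.goldenRatio - 1 := sub_pos.2 Real.one_lt_goldenRatio
  have h1 := det_rhs T hT.colorable_two _ _ hcd hcd2
  have h2 := main_ind _ _ hc hd hcd hcd2 _ T T.edgeFinset (by simp) hT.isAcyclic rfl
    (fun _ => 1) (fun _ => 0) (by simp) (by simp)
  simp only [mul_one, mul_zero, add_zero] at h2
  rw [h1, Complex.ofReal_inj] at h2
  obtain ⟨F, hF⟩ : ∃ F : Finset (Sym2 (Fin 4 × V)),
      (F : Set (Sym2 (Fin 4 × V))) = (pathGraph 4 □ T).edgeSet :=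
    ⟨(pathGraph 4 □ T).edgeSet.toFinset, by simp⟩
  rw [← h2, Pm_eq_bint (pathGraph 4 □ T) F hF, boxProd_prod T T.edgeFinset (by simp) _ F hF]
  have e1 : ∀ v : V, (1 + (Sym2.map (fun x => (MvPolynomial.X x : MvPolynomial (Fin 4 × V) ℝ))
        s((0, v), (1, v))).mul) *
      (1 + (Sym2.map (fun x => (MvPolynomial.X x : MvPolynomial (Fin 4 × V) ℝ))
        s((1, v), (2, v))).mul) *
      (1 + (Sym2.map (fun x => (MvPolynomial.X x : MvPolynomial (Fin 4 × V) ℝ))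
        s((2, v), (3, v))).mul) = wpr 1 1 0 v := by
    intro v
    simp [wpr]
  have e2 : ∀ e : Sym2 V, (∏ i : Fin 4,
      (1 + (Sym2.map (fun x => (MvPolynomial.X x : MvPolynomial (Fin 4 × V) ℝ))
        (e.map (fun v => (i, v)))).mul)) = edg e := by
    intro e
    simp only [edg, Sym2.map_map, Function.comp_def]
  simp only [e1, e2]
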